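/- Let d ≥ 2 be an integer. There is a constant C > 0, depending only on d, such that for all r > 0, ρ > 0 and every solid cylinder K of radius ρ in ℝ^d, the (d−1)-dimensional Hausdorff measure of 𝕊_r^{d-1} ∩ K is at most C r^{d-1} min{1, (ρ/r)^{(d-1)/2}}. -/

import Mathlib

open MeasureTheory

/-- `K` is a solid cylinder of radius `ρ` in ℝ^d: the set of points at distance at most `ρ`
from some affine line. -/
def IsSolidCylinder {d : ℕ} (ρ : ℝ) (K : Set (EuclideanSpace ℝ (Fin d))) : Prop :=
  ∃ p u : EuclideanSpace ℝ (Fin d), u ≠ 0 ∧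
    K = {x | Metric.infDist x {y | ∃ t : ℝ, y = p + t • u} ≤ ρ}

open scoped NNReal ENNReal in
/-- A map which is antilipschitz on a set does not decrease its Hausdorff measure by more than
the corresponding power of the constant. -/
lemma hausdorffMeasure_le_image_of_dist_le {X Y : Type*} [MetricSpace X] [MetricSpace Y]
    [MeasurableSpace X] [BorelSpace X] [MeasurableSpace Y] [BorelSpace Y]
    {f : X → Y} {s : Set X} {K : ℝ≥0} {m : ℝ} (hm : 0 ≤ m)
    (h : ∀ x ∈ s, ∀ y ∈ s, dist x y ≤ K * dist (f x) (f y)) :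
    μH[m] s ≤ (K : ℝ≥0∞) ^ m * μH[m] (f '' s) := by
  have hanti : AntilipschitzWith K (fun x : s => f x) :=
    AntilipschitzWith.of_le_mul_dist fun x y => h x x.2 y y.2
  have h1 := hanti.le_hausdorffMeasure_image hm Set.univ
  have h2 := (isometry_subtype_coe (s := s)).hausdorffMeasure_image (d := m) (Or.inl hm) Set.univ
  rw [Set.image_univ, Subtype.range_coe] at h2
  rw [h2]
  refine h1.trans_eq ?_
  rw [Set.image_univ, ← Function.comp_def f, Set.range_comp, Subtype.range_coe]

/-- On the part of a sphere where a coordinate is large with constant sign, forgetting this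
coordinate is antilipschitz. -/
lemma dist_le_dist_removeNth {n : ℕ} {r : ℝ} (hr : 0 < r) (i : Fin (n + 1))
    {x y : EuclideanSpace ℝ (Fin (n + 1))} (hx : ‖x‖ = r) (hy : ‖y‖ = r) {σ : ℝ}
    (hσ : σ ^ 2 = 1) (hxi : r / (n + 1) ≤ σ * x i) (hyi : r / (n + 1) ≤ σ * y i) :
    dist x y ≤ (n + 1) * (1 + 2 * n * (n + 1)) *
      dist (fun j : Fin n => x (i.succAbove j)) (fun j : Fin n => y (i.succAbove j)) := by
  set D := dist (fun j : Fin n => x (i.succAbove j)) (fun j : Fin n => y (i.succAbove j)) with hD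
  have hD0 : 0 ≤ D := dist_nonneg
  have hn : (0 : ℝ) < n + 1 := by positivity
  have hj : ∀ j, |x (i.succAbove j) - y (i.succAbove j)| ≤ D := fun j => by
    rw [← Real.dist_eq]
    exact dist_le_pi_dist (fun j : Fin n => x (i.succAbove j)) (fun j => y (i.succAbove j)) j
  have hxj : ∀ j, |x j| ≤ r := fun j => by simpa [hx] using PiLp.norm_apply_le x j
  have hyj : ∀ j, |y j| ≤ r := fun j => by simpa [hy] using PiLp.norm_apply_le y j
  have hxs : ∑ j, x j ^ 2 = r ^ 2 := by rw [← hx, EuclideanSpace.real_norm_sq_eq]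
  have hys : ∑ j, y j ^ 2 = r ^ 2 := by rw [← hy, EuclideanSpace.real_norm_sq_eq]
  rw [Fin.sum_univ_succAbove _ i] at hxs hys
  have hdiff : (x i - y i) * (x i + y i)
      = ∑ j : Fin n, (y (i.succAbove j) ^ 2 - x (i.succAbove j) ^ 2) := by
    rw [Finset.sum_sub_distrib]; linarith
  have hprod : |x i - y i| * |x i + y i| ≤ n * (D * (2 * r)) := by
    rw [← abs_mul, hdiff]
    refine (Finset.abs_sum_le_sum_abs _ _).trans ?_
    refine (Finset.sum_le_card_nsmul _ _ (D * (2 * r)) fun j _ => ?_).trans_eq (by simp)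
    rw [show y (i.succAbove j) ^ 2 - x (i.succAbove j) ^ 2
      = -((x (i.succAbove j) - y (i.succAbove j)) * (x (i.succAbove j) + y (i.succAbove j))) by
        ring, abs_neg, abs_mul]
    refine mul_le_mul (hj j) ?_ (abs_nonneg _) hD0
    exact (abs_add_le _ _).trans (by linarith [hxj (i.succAbove j), hyj (i.succAbove j)])
  have hσ' : |σ| = 1 := by
    rcases mul_self_eq_one_iff.1 ((sq σ).symm.trans hσ) with h | h <;> simp [h]
  have hsum : r / (n + 1) ≤ |x i + y i| := by
    have h1 : σ * (x i + y i) ≤ |x i + y i| := by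
      simpa [abs_mul, hσ'] using le_abs_self (σ * (x i + y i))
    have : 0 < r / (n + 1 : ℝ) := by positivity
    linarith
  have hi : |x i - y i| ≤ 2 * n * (n + 1) * D := by
    have h1 := (mul_le_mul_of_nonneg_left hsum (abs_nonneg (x i - y i))).trans hprod
    rw [← mul_div_assoc, div_le_iff₀ hn] at h1
    refine le_of_mul_le_mul_right ?_ hr
    linarith
  have hall : ∀ j, |x j - y j| ≤ (1 + 2 * n * (n + 1)) * D := fun j => by
    have : 0 ≤ 2 * n * (n + 1) * D := by positivity
    rcases Fin.eq_self_or_eq_succAbove i j with rfl | ⟨k, rfl⟩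
    · linarith
    · linarith [hj k]
  have hM : 0 ≤ (1 + 2 * n * (n + 1)) * D := by positivity
  rw [dist_eq_norm, mul_assoc]
  refine abs_le_of_sq_le_sq' ?_ (by positivity) |>.2
  rw [EuclideanSpace.real_norm_sq_eq]
  calc ∑ j, (x - y) j ^ 2 ≤ ∑ _j : Fin (n + 1), ((1 + 2 * n * (n + 1)) * D) ^ 2 :=
        Finset.sum_le_sum fun j _ => sq_le_sq' (abs_le.1 (hall j)).1 (abs_le.1 (hall j)).2
    _ = (n + 1) * ((1 + 2 * n * (n + 1)) * D) ^ 2 := by simp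
    _ ≤ (n + 1) ^ 2 * ((1 + 2 * n * (n + 1)) * D) ^ 2 := by
        gcongr
        have : (0 : ℝ) ≤ n := by positivity
        nlinarith
    _ = _ := by ring

/-- A point of a sphere has a coordinate comparable to its norm. -/
lemma exists_le_abs_coord {n : ℕ} (x : EuclideanSpace ℝ (Fin (n + 1))) :
    ∃ i, ‖x‖ / (n + 1) ≤ |x i| := by
  by_contra! h
  have hn : (0 : ℝ) < n + 1 := by positivity
  have h1 : ‖x‖ ^ 2 < ∑ _j : Fin (n + 1), (‖x‖ / (n + 1)) ^ 2 := by
    rw [EuclideanSpace.real_norm_sq_eq]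
    refine Finset.sum_lt_sum_of_nonempty Finset.univ_nonempty fun j _ => ?_
    rw [← sq_abs]
    exact pow_lt_pow_left₀ (h j) (abs_nonneg _) two_ne_zero
  simp only [Finset.sum_const, Finset.card_univ, Fintype.card_fin, nsmul_eq_mul] at h1
  push_cast at h1
  rw [div_pow, ← mul_div_assoc, lt_div_iff₀ (by positivity)] at h1
  have h0 : (0 : ℝ) ≤ n := by positivity
  nlinarith [mul_nonneg h0 (mul_nonneg hn.le (sq_nonneg ‖x‖))]

open scoped NNReal ENNReal in
/-- The surface measure of a subset of a sphere in `ℝ^(n+1)` is at most a constant times the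
`n`-th power of its diameter, uniformly in the radius. -/
lemma exists_hausdorffMeasure_le_diam_pow (n : ℕ) :
    ∃ C > 0, ∀ r δ : ℝ, 0 < r → 0 ≤ δ → ∀ A : Set (EuclideanSpace ℝ (Fin (n + 1))),
      A ⊆ Metric.sphere 0 r → (∀ x ∈ A, ∀ y ∈ A, dist x y ≤ δ) →
        μH[(n : ℝ)] A ≤ ENNReal.ofReal (C * δ ^ n) := by
  set L : ℝ≥0 := (n + 1) * (1 + 2 * n * (n + 1)) with hL
  have hLpos : 0 < L := by positivity
  refine ⟨(n + 1) * 2 * (L ^ n * 2 ^ n), by positivity, fun r δ hr hδ A hA hdiam => ?_⟩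
  have key : ∀ (i : Fin (n + 1)) (σ : ℝ), σ ^ 2 = 1 →
      μH[(n : ℝ)] {x ∈ A | r / (n + 1) ≤ σ * x i} ≤ ENNReal.ofReal (L ^ n * 2 ^ n * δ ^ n) := by
    intro i σ hσ
    set P := {x ∈ A | r / (n + 1) ≤ σ * x i}
    set f : EuclideanSpace ℝ (Fin (n + 1)) → Fin n → ℝ := fun x j => x (i.succAbove j)
    have h1 : μH[(n : ℝ)] P ≤ (L : ℝ≥0∞) ^ (n : ℝ) * μH[(n : ℝ)] (f '' P) := by
      refine hausdorffMeasure_le_image_of_dist_le (Nat.cast_nonneg n) fun x hx y hy => ?_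
      have := dist_le_dist_removeNth hr i (by simpa using hA hx.1) (by simpa using hA hy.1)
        hσ hx.2 hy.2
      simpa [hL, f] using this
    have h2 : μH[(n : ℝ)] (f '' P) ≤ ENNReal.ofReal ((2 * δ) ^ n) := by
      rcases P.eq_empty_or_nonempty with hP | ⟨a, ha⟩
      · simp [hP]
      have hvol := hausdorffMeasure_pi_real (ι := Fin n)
      rw [Fintype.card_fin] at hvol
      rw [hvol]
      refine (measure_mono (t := Metric.closedBall (f a) δ) ?_).trans_eq ?_
      · rintro _ ⟨x, hx, rfl⟩
        rw [Metric.mem_closedBall, dist_pi_le_iff hδ]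
        intro j
        have := PiLp.norm_apply_le (x - a) (i.succAbove j)
        rw [← dist_eq_norm] at this
        exact this.trans (hdiam x hx.1 a ha.1)
      · simp [Real.volume_pi_closedBall _ hδ]
    refine h1.trans ((mul_le_mul_right h2 _).trans_eq ?_)
    rw [ENNReal.rpow_natCast, mul_pow, mul_assoc,
      ENNReal.ofReal_mul (pow_nonneg L.coe_nonneg n),
      ENNReal.ofReal_pow L.coe_nonneg n, ENNReal.ofReal_coe_nnreal]
  have hcover : A ⊆ ⋃ i : Fin (n + 1), ({x ∈ A | r / (n + 1) ≤ 1 * x i} ∪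
      {x ∈ A | r / (n + 1) ≤ -1 * x i}) := by
    intro x hx
    obtain ⟨i, hi⟩ := exists_le_abs_coord x
    rw [show ‖x‖ = r by simpa using hA hx] at hi
    refine Set.mem_iUnion.2 ⟨i, ?_⟩
    rcases le_abs.1 hi with h | h
    · exact Or.inl ⟨hx, by simpa using h⟩
    · exact Or.inr ⟨hx, by simpa using h⟩
  have h0 : 0 ≤ (L : ℝ) ^ n * 2 ^ n * δ ^ n := by positivity
  calc μH[(n : ℝ)] A ≤ ∑ i : Fin (n + 1), μH[(n : ℝ)] ({x ∈ A | r / (n + 1) ≤ 1 * x i} ∪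
      {x ∈ A | r / (n + 1) ≤ -1 * x i}) :=
        (measure_mono hcover).trans (measure_iUnion_fintype_le _ _)
    _ ≤ ∑ _i : Fin (n + 1), ENNReal.ofReal (2 * (L ^ n * 2 ^ n * δ ^ n)) := by
        refine Finset.sum_le_sum fun i _ => (measure_union_le _ _).trans ?_
        rw [two_mul, ENNReal.ofReal_add h0 h0]
        exact add_le_add (key i 1 (by norm_num)) (key i (-1) (by norm_num))
    _ = ENNReal.ofReal ((n + 1) * 2 * (L ^ n * 2 ^ n) * δ ^ n) := by
        rw [← ENNReal.ofReal_sum_of_nonneg fun _ _ => by positivity]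
        congr 1
        simp
        ring

/-- Two points of a sphere of radius `r` that lie, up to `2 * ρ`, on a common line, and on the
same side of the hyperplane orthogonal to this line, are at distance `O(√(ρ * r))`. -/
lemma dist_sq_le_of_mem_sphere_of_near_line {E : Type*} [NormedAddCommGroup E]
    [InnerProductSpace ℝ E] {p e x y : E} {r ρ t s : ℝ} (he : ‖e‖ = 1)
    (hρ : 0 < ρ) (hρr : ρ ≤ r) (hx : ‖x‖ = r) (hy : ‖y‖ = r)
    (hxt : dist x (p + t • e) ≤ 2 * ρ) (hys : dist y (p + s • e) ≤ 2 * ρ)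
    (hside : 0 ≤ inner ℝ x e * inner ℝ y e) :
    dist x y ^ 2 ≤ 25 * (ρ * r) := by
  set a := inner ℝ x e with ha
  set b := inner ℝ y e with hb
  set v := x - a • e with hv
  set w := y - b • e with hw
  have hee : inner ℝ e e = (1 : ℝ) := by rw [real_inner_self_eq_norm_sq, he]; norm_num
  have pyth : ∀ z : E, ‖z‖ ^ 2 = inner ℝ z e ^ 2 + ‖z - (inner ℝ z e : ℝ) • e‖ ^ 2 := fun z => by
    rw [norm_sub_sq_real, inner_smul_right, norm_smul, he, mul_one, Real.norm_eq_abs, sq_abs]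
    ring
  have hxv : r ^ 2 = a ^ 2 + ‖v‖ ^ 2 := by rw [← hx]; exact pyth x
  have hyw : r ^ 2 = b ^ 2 + ‖w‖ ^ 2 := by rw [← hy]; exact pyth y
  have hxy : ‖x - y‖ ^ 2 = (a - b) ^ 2 + ‖v - w‖ ^ 2 := by
    rw [pyth (x - y), inner_sub_left, ← ha, ← hb]
    congr 3
    rw [hv, hw, sub_smul]; abel
  have hvw : ‖v - w‖ ≤ 4 * ρ := by
    set z := (x - (p + t • e)) - (y - (p + s • e)) with hz
    have hz4 : ‖z‖ ≤ 4 * ρ := by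
      rw [dist_eq_norm] at hxt hys
      exact (norm_sub_le _ _).trans (by linarith)
    have hzi : (inner ℝ z e : ℝ) = a - b - (t - s) := by
      simp only [hz, inner_sub_left, inner_add_left, real_inner_smul_left, hee]
      ring
    have hzv : z - (inner ℝ z e : ℝ) • e = v - w := by
      rw [hzi, hz, hv, hw]
      module
    have := pyth z
    rw [hzv] at this
    refine (abs_le_of_sq_le_sq' ?_ (norm_nonneg z)).2.trans hz4
    nlinarith [sq_nonneg (inner ℝ z e : ℝ)]
  have hr : 0 < r := hρ.trans_le hρr
  have hvr : ‖v‖ ≤ r := (abs_le_of_sq_le_sq' (by nlinarith [sq_nonneg a]) hr.le).2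
  have hwr : ‖w‖ ≤ r := (abs_le_of_sq_le_sq' (by nlinarith [sq_nonneg b]) hr.le).2
  have hab : (a - b) ^ 2 ≤ |a ^ 2 - b ^ 2| := by
    rw [← sq_abs, show a ^ 2 - b ^ 2 = (a - b) * (a + b) by ring, abs_mul, sq]
    refine mul_le_mul_of_nonneg_left (sq_le_sq.1 ?_) (abs_nonneg _)
    nlinarith
  have hab' : |a ^ 2 - b ^ 2| ≤ 4 * ρ * (2 * r) := by
    rw [show a ^ 2 - b ^ 2 = -((‖v‖ - ‖w‖) * (‖v‖ + ‖w‖)) by nlinarith, abs_neg, abs_mul]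
    refine mul_le_mul ((abs_norm_sub_norm_le v w).trans hvw) ?_ (abs_nonneg _) (by positivity)
    rw [abs_of_nonneg (by positivity)]
    linarith
  rw [dist_eq_norm, hxy]
  nlinarith [norm_nonneg (v - w), mul_le_mul hvw hvw (norm_nonneg _) (by positivity)]

theorem stmt_3 (d : ℕ) (hd : 2 ≤ d) :
    ∃ C > 0, ∀ r ρ : ℝ, 0 < r → 0 < ρ →
      ∀ K : Set (EuclideanSpace ℝ (Fin d)), IsSolidCylinder ρ K →
        μH[(d : ℝ) - 1] (Metric.sphere (0 : EuclideanSpace ℝ (Fin d)) r ∩ K)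
          ≤ ENNReal.ofReal (C * r ^ (d - 1) * min 1 ((ρ / r) ^ (((d : ℝ) - 1) / 2))) := by
  obtain ⟨n, rfl⟩ : ∃ n, d = n + 1 := ⟨d - 1, by omega⟩
  obtain ⟨C, hC, hmain⟩ := exists_hausdorffMeasure_le_diam_pow n
  refine ⟨2 * C * 5 ^ n, by positivity, fun r ρ hr hρ K hK => ?_⟩
  have hdim : ((n + 1 : ℕ) : ℝ) - 1 = n := by push_cast; ring
  rw [hdim, Nat.add_sub_cancel]
  have hq : 0 < ρ / r := by positivity
  rcases le_total ρ r with hρr | hrρ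
  · have hpow : (ρ / r) ^ ((n : ℝ) / 2) = √(ρ / r) ^ n := by
      rw [Real.sqrt_eq_rpow, ← Real.rpow_natCast, ← Real.rpow_mul hq.le]
      congr 1; ring
    have hq1 : √(ρ / r) ^ n ≤ 1 :=
      pow_le_one₀ (Real.sqrt_nonneg _) (Real.sqrt_le_one.2 ((div_le_one hr).2 hρr))
    rw [hpow, min_eq_right hq1]
    obtain ⟨p, u, hu, rfl⟩ := hK
    set L := {y | ∃ t : ℝ, y = p + t • u} with hL
    set A := Metric.sphere (0 : EuclideanSpace ℝ (Fin (n + 1))) r ∩ {x | Metric.infDist x L ≤ ρ}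
    set e := ‖u‖⁻¹ • u with he_def
    have hu' : ‖u‖ ≠ 0 := norm_ne_zero_iff.2 hu
    have he : ‖e‖ = 1 := by rw [he_def, norm_smul, norm_inv, norm_norm, inv_mul_cancel₀ hu']
    have hne : L.Nonempty := ⟨p, 0, by simp⟩
    have hnear : ∀ x ∈ A, ∃ t : ℝ, dist x (p + t • e) ≤ 2 * ρ := by
      intro x hx
      have hlt : Metric.infDist x L < 2 * ρ := lt_of_le_of_lt hx.2 (by linarith)
      obtain ⟨_, ⟨t, rfl⟩, hy⟩ := (Metric.infDist_lt_iff hne).1 hlt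
      refine ⟨t * ‖u‖, ?_⟩
      rw [he_def, smul_smul, mul_assoc, mul_inv_cancel₀ hu', mul_one]
      exact hy.le
    set δ := 5 * (r * √(ρ / r)) with hδ
    have hδ0 : 0 ≤ δ := by positivity
    have hδ2 : δ ^ 2 = 25 * (ρ * r) := by
      rw [hδ, mul_pow, mul_pow, Real.sq_sqrt hq.le]
      field_simp
      norm_num
    have hdist : ∀ x ∈ A, ∀ y ∈ A, 0 ≤ inner ℝ x e * inner ℝ y e → dist x y ≤ δ := by
      intro x hx y hy hxy
      obtain ⟨t, ht⟩ := hnear x hx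
      obtain ⟨s, hs⟩ := hnear y hy
      refine (abs_le_of_sq_le_sq' ?_ hδ0).2
      rw [hδ2]
      exact dist_sq_le_of_mem_sphere_of_near_line he hρ hρr (by simpa using hx.1)
        (by simpa using hy.1) ht hs hxy
    have hcover : A ⊆ {x ∈ A | 0 ≤ inner ℝ x e} ∪ {x ∈ A | inner ℝ x e ≤ 0} := fun x hx =>
      (le_total 0 (inner ℝ x e)).imp (fun h => ⟨hx, h⟩) fun h => ⟨hx, h⟩
    refine (measure_mono hcover).trans ((measure_union_le _ _).trans ?_)
    have h1 := hmain r δ hr hδ0 {x ∈ A | 0 ≤ inner ℝ x e} (fun x hx => hx.1.1)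
      fun x hx y hy => hdist x hx.1 y hy.1 (mul_nonneg hx.2 hy.2)
    have h2 := hmain r δ hr hδ0 {x ∈ A | inner ℝ x e ≤ 0} (fun x hx => hx.1.1)
      fun x hx y hy => hdist x hx.1 y hy.1 (mul_nonneg_of_nonpos_of_nonpos hx.2 hy.2)
    refine (add_le_add h1 h2).trans_eq ?_
    rw [← ENNReal.ofReal_add (by positivity) (by positivity), hδ, mul_pow, mul_pow]
    congr 1; ring
  · have hq1 : 1 ≤ (ρ / r) ^ ((n : ℝ) / 2) :=
      Real.one_le_rpow ((one_le_div hr).2 hrρ) (by positivity)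
    rw [min_eq_left hq1]
    refine (hmain r (2 * r) hr (by positivity) _ Set.inter_subset_left ?_).trans
      (ENNReal.ofReal_le_ofReal ?_)
    · intro x hx y hy
      have hx' := Metric.mem_sphere.1 hx.1
      have hy' := Metric.mem_sphere.1 hy.1
      linarith [dist_triangle_right x y 0]
    · have h25 : (2 : ℝ) ^ n ≤ 5 ^ n := by gcongr; norm_num
      have h0 : 0 ≤ C * r ^ n := by positivity
      have h5 : (0 : ℝ) ≤ 5 ^ n := by positivity
      rw [mul_pow]
      nlinarith [mul_le_mul_of_nonneg_left h25 h0, mul_nonneg h0 h5]
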